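/- Let n ≥ 2, let K be a finite subgroup of ℍˣ, and let H be a subgroup of K containing the commutator subgroup [K, K]. Then the set G_n(K, H) := { diag(b₁, …, b_{n−1}, (b₁·b₂⋯b_{n−1})⁻¹·h) · P_σ : b₁, …, b_{n−1} ∈ K, h ∈ H, σ ∈ S_n } is a subgroup of GL_n(ℍ), and its order equals n!·|H|·|K|^{n−1}. -/

import Mathlib

noncomputable section

open Matrix

local notation "ℍ" => Quaternion ℝ

section Monomial

variable {ι R : Type*} [Fintype ι] [DecidableEq ι] [Ring R]

/-- The monomial matrix with entry `c i` in position `(i, σ i)`. -/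
def monomialMatrix (c : ι → Rˣ) (σ : Equiv.Perm ι) : Matrix ι ι R :=
  diagonal (fun i => (c i : R)) * σ.permMatrix R

theorem monomialMatrix_apply (c : ι → Rˣ) (σ : Equiv.Perm ι) (i j : ι) :
    monomialMatrix c σ i j = if σ i = j then (c i : R) else 0 := by
  simp [monomialMatrix, diagonal_mul, PEquiv.toMatrix_apply, eq_comm]

theorem monomialMatrix_mul (c d : ι → Rˣ) (σ τ : Equiv.Perm ι) :
    monomialMatrix c σ * monomialMatrix d τ = monomialMatrix (fun i => c i * d (σ i)) (τ * σ) := by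
  ext i j
  rw [mul_apply, Finset.sum_eq_single (σ i)]
  · simp only [monomialMatrix_apply, if_true, mul_ite, mul_zero, Units.val_mul]
    rfl
  · intro k _ hk
    simp [monomialMatrix_apply, hk.symm]
  · simp

theorem monomialMatrix_one :
    monomialMatrix (1 : ι → Rˣ) 1 = (1 : Matrix ι ι R) := by
  simp [monomialMatrix]

/-- A monomial matrix with unit entries as an element of the general linear group. -/
def monomialUnit (c : ι → Rˣ) (σ : Equiv.Perm ι) : (Matrix ι ι R)ˣ where
  val := monomialMatrix c σ
  inv := monomialMatrix (fun i => (c (σ⁻¹ i))⁻¹) σ⁻¹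
  val_inv := by simp [monomialMatrix_mul, ← monomialMatrix_one, Pi.one_def]
  inv_val := by simp [monomialMatrix_mul, ← monomialMatrix_one, Pi.one_def]

theorem monomialMatrix_injective [Nontrivial R] :
    Function.Injective fun p : (ι → Rˣ) × Equiv.Perm ι => monomialMatrix p.1 p.2 := by
  rintro ⟨c, σ⟩ ⟨d, τ⟩ h
  have key (i : ι) : τ i = σ i ∧ c i = d i := by
    have hi := congrFun (congrFun h i) (σ i)
    simp only [monomialMatrix_apply, if_true] at hi
    split_ifs at hi with hτ
    · exact ⟨hτ, Units.ext hi⟩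
    · exact absurd hi (c i).ne_zero
  exact Prod.ext (funext fun i => (key i).2) (Equiv.ext fun i => (key i).1.symm)

/-- The monomial matrices with entries in `K` such that the product of the images of the entries
in a commutative group lies in `B`. -/
def monomialSubgroup {A : Type*} [CommGroup A] {K : Subgroup Rˣ} (φ : K →* A) (B : Subgroup A) :
    Subgroup (Matrix ι ι R)ˣ where
  carrier := {U | ∃ (c : ι → K) (σ : Equiv.Perm ι), ∏ i, φ (c i) ∈ B ∧
    U.val = monomialMatrix (fun i => (c i : Rˣ)) σ}
  one_mem' := ⟨1, 1, by simp, monomialMatrix_one.symm⟩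
  mul_mem' := by
    rintro U V ⟨c, σ, hc, hU⟩ ⟨d, τ, hd, hV⟩
    refine ⟨fun i => c i * d (σ i), τ * σ, ?_, ?_⟩
    · simp only [map_mul, Finset.prod_mul_distrib]
      rw [Equiv.prod_comp σ fun i => φ (d i)]
      exact mul_mem hc hd
    · simp [hU, hV, monomialMatrix_mul]
  inv_mem' := by
    rintro U ⟨c, σ, hc, hU⟩
    refine ⟨fun i => (c (σ⁻¹ i))⁻¹, σ⁻¹, ?_, ?_⟩
    · simp only [map_inv, Finset.prod_inv_distrib]
      rw [Equiv.prod_comp σ⁻¹ fun i => φ (c i)]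
      exact inv_mem hc
    · obtain rfl : U = monomialUnit (fun i => (c i : Rˣ)) σ := Units.ext hU
      rfl

end Monomial

section Completion

variable {G : Type*} [Group G] {n : ℕ}

/-- Append to `d` the entry that makes the ordered product of all entries equal to `h`. -/
def completeProd (d : Fin (n - 1) → G) (h : G) (i : Fin n) : G :=
  if hi : (i : ℕ) < n - 1 then d ⟨i, hi⟩ else (List.ofFn d).prod⁻¹ * h

theorem prod_ofFn_completeProd (hn : n ≠ 0) (d : Fin (n - 1) → G) (h : G) :
    (List.ofFn (completeProd d h)).prod = h := by
  obtain ⟨m, rfl⟩ := Nat.exists_eq_succ_of_ne_zero hn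
  rw [List.ofFn_succ']
  simp [completeProd]

theorem completeProd_castLE (d : Fin (n - 1) → G) (h : G) (i : Fin (n - 1)) :
    completeProd d h (i.castLE (Nat.sub_le n 1)) = d i := by
  simp [completeProd]

theorem completeProd_self (hn : n ≠ 0) (c : Fin n → G) :
    completeProd (fun i => c (i.castLE (Nat.sub_le n 1))) (List.ofFn c).prod = c := by
  obtain ⟨m, rfl⟩ := Nat.exists_eq_succ_of_ne_zero hn
  ext i
  refine Fin.lastCases ?_ (fun i => ?_) i
  · simp only [completeProd, List.ofFn_succ' c]
    simp [Fin.castLE, Fin.castSucc, Fin.castAdd]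
  · simp [completeProd, Fin.castLE, Fin.castSucc, Fin.castAdd]

theorem completeProd_injective (hn : n ≠ 0) :
    Function.Injective fun p : (Fin (n - 1) → G) × G => completeProd p.1 p.2 := by
  rintro ⟨d, h⟩ ⟨d', h'⟩ e
  replace e : completeProd d h = completeProd d' h' := e
  refine Prod.ext (funext fun i => ?_) ?_
  · simpa only [completeProd_castLE] using congrFun e (i.castLE (Nat.sub_le n 1))
  · simpa only [prod_ofFn_completeProd hn] using congrArg (fun c => (List.ofFn c).prod) e

theorem completeProd_mem {K : Subgroup G} {d : Fin (n - 1) → G} {h : G} (hd : ∀ i, d i ∈ K)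
    (hh : h ∈ K) (i : Fin n) : completeProd d h i ∈ K := by
  unfold completeProd
  split_ifs
  · exact hd _
  · refine mul_mem (inv_mem (list_prod_mem fun x hx => ?_)) hh
    obtain ⟨j, rfl⟩ := (List.mem_ofFn' d x).1 hx
    exact hd j

theorem prod_abelianization_mem_map_iff {K H : Subgroup G} (hcomm : ⁅K, K⁆ ≤ H) (c : Fin n → K) :
    ∏ i, Abelianization.of (c i) ∈ (H.subgroupOf K).map Abelianization.of ↔
      (List.ofFn fun i => (c i : G)).prod ∈ H := by
  have hker : (Abelianization.of (G := K)).ker ≤ H.subgroupOf K := by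
    rw [Abelianization.ker_of, Subgroup.subgroupOf, ← Subgroup.map_le_iff_le_comap]
    exact K.map_subtype_commutator.trans_le hcomm
  have hof : ∏ i, Abelianization.of (c i) = Abelianization.of (List.ofFn c).prod := by
    rw [← List.prod_ofFn, map_list_prod, List.map_ofFn, Function.comp_def]
  rw [hof, ← Subgroup.mem_comap, Subgroup.comap_map_eq_self hker, Subgroup.mem_subgroupOf,
    SubmonoidClass.coe_list_prod, List.map_ofFn, Function.comp_def]

end Completion

theorem statement_19 (n : ℕ) (hn : 2 ≤ n) (K H : Subgroup ℍˣ)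
    (hKfin : Finite K) (hHK : H ≤ K) (hcomm : ⁅K, K⁆ ≤ H) :
    ∃ Γ : Subgroup (Matrix (Fin n) (Fin n) ℍ)ˣ,
      (Units.val '' (Γ : Set ((Matrix (Fin n) (Fin n) ℍ)ˣ)) =
        {M : Matrix (Fin n) (Fin n) ℍ |
          ∃ (d : Fin (n - 1) → ℍˣ) (h : ℍˣ) (σ : Equiv.Perm (Fin n)),
            (∀ i, d i ∈ K) ∧ h ∈ H ∧
            M = Matrix.diagonal
                  (fun i : Fin n => if hi : (i : ℕ) < n - 1 then ((d ⟨i, hi⟩ : ℍˣ) : ℍ)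
                    else (((List.ofFn d).prod⁻¹ * h : ℍˣ) : ℍ)) * σ.permMatrix ℍ}) ∧
      Nat.card Γ = n.factorial * Nat.card H * Nat.card K ^ (n - 1) := by
  have hn0 : n ≠ 0 := by lia
  let F (p : ((Fin (n - 1) → K) × H) × Equiv.Perm (Fin n)) : Matrix (Fin n) (Fin n) ℍ :=
    monomialMatrix (completeProd (fun i => (p.1.1 i : ℍˣ)) p.1.2) p.2
  have hF : Function.Injective F := by
    rintro ⟨⟨d, h⟩, σ⟩ ⟨⟨d', h'⟩, σ'⟩ e
    obtain ⟨e₁, rfl⟩ := Prod.ext_iff.1 (monomialMatrix_injective (a₁ := (_, _)) (a₂ := (_, _)) e)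
    obtain ⟨e₂, e₃⟩ := Prod.ext_iff.1 (completeProd_injective hn0 (a₁ := (_, _)) (a₂ := (_, _)) e₁)
    obtain rfl : d = d' := funext fun i => Subtype.ext (congrFun e₂ i)
    obtain rfl : h = h' := Subtype.ext e₃
    rfl
  let Γ : Subgroup (Matrix (Fin n) (Fin n) ℍ)ˣ :=
    monomialSubgroup (Abelianization.of (G := K)) ((H.subgroupOf K).map Abelianization.of)
  have hΓ : Units.val '' (Γ : Set (Matrix (Fin n) (Fin n) ℍ)ˣ) = Set.range F := by
    ext M
    constructor
    · rintro ⟨U, ⟨c, σ, hc, hU⟩, rfl⟩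
      rw [prod_abelianization_mem_map_iff hcomm] at hc
      refine ⟨((fun i => c (i.castLE (Nat.sub_le n 1)), ⟨_, hc⟩), σ), ?_⟩
      rw [hU]
      exact congrArg (monomialMatrix · σ) (completeProd_self hn0 fun i => (c i : ℍˣ))
    · rintro ⟨⟨⟨d, h⟩, σ⟩, rfl⟩
      refine ⟨monomialUnit (completeProd (fun i => (d i : ℍˣ)) h) σ,
        ⟨fun i => ⟨_, completeProd_mem (fun i => (d i).2) (hHK h.2) i⟩, σ, ?_, rfl⟩, rfl⟩
      rw [prod_abelianization_mem_map_iff hcomm, prod_ofFn_completeProd hn0]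
      exact h.2
  refine ⟨Γ, ?_, ?_⟩
  · rw [hΓ]
    have hdiag (d : Fin (n - 1) → ℍˣ) (h : ℍˣ) (σ : Equiv.Perm (Fin n)) :
        monomialMatrix (completeProd d h) σ = Matrix.diagonal
          (fun i : Fin n => if hi : (i : ℕ) < n - 1 then ((d ⟨i, hi⟩ : ℍˣ) : ℍ)
            else (((List.ofFn d).prod⁻¹ * h : ℍˣ) : ℍ)) * σ.permMatrix ℍ := by
      simp only [monomialMatrix, completeProd, apply_dite Units.val]
    ext M
    constructor
    · rintro ⟨⟨⟨d, h⟩, σ⟩, rfl⟩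
      exact ⟨fun i => d i, h, σ, fun i => (d i).2, h.2, hdiag _ _ _⟩
    · rintro ⟨d, h, σ, hd, hh, rfl⟩
      exact ⟨((fun i => ⟨d i, hd i⟩, ⟨h, hh⟩), σ), hdiag _ _ _⟩
  · calc Nat.card Γ
        = Nat.card (Units.val '' (Γ : Set (Matrix (Fin n) (Fin n) ℍ)ˣ)) :=
          (Nat.card_image_of_injective Units.val_injective _).symm
      _ = Nat.card (((Fin (n - 1) → K) × H) × Equiv.Perm (Fin n)) := by
          rw [hΓ]
          exact Nat.card_congr (Equiv.ofInjective F hF).symm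
      _ = n.factorial * Nat.card H * Nat.card K ^ (n - 1) := by
          rw [Nat.card_prod, Nat.card_prod, Nat.card_fun, Nat.card_perm, Nat.card_fin, Nat.card_fin]
          ring

end
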